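/- arXiv:1908.01650 — 2 statements merged into one kernel-verified Lean document; each statement's English description precedes it below -/
import Mathlib

section
/- Let p be an odd prime and let f : F_q → F_p satisfy condition (★). Then C_f is a [p^m − 1, m + 1] linear code over F_p, and the Hamming weight of the codeword (u f(x) − Tr(vx))_{x∈F_q^*} equals: 0 if u = 0 and v = 0; p^m − p^{m−1} if u = 0 and v ≠ 0; and p^m − p^{m−1} − (1/p)·Σ_{c∈F_p^*} Σ_{x∈F_q} ζ_p^{c·(u f(x) − Tr(vx))} if u ≠ 0 (this last sum equals Σ_{a∈F_p^*} σ_a(σ_u(f̂(u^{−1}v))), where σ_a is the automorphism of Q(ζ_p) sending ζ_p to ζ_p^a). -/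
open Finset

/-- The `p`-th root of unity `exp (2πi/p)` to the power `a.val` is the standard additive
character of `ZMod p` at `a`. -/
lemma exp_pow_val_eq_stdAddChar (p : ℕ) [NeZero p] (a : ZMod p) :
    Complex.exp (2 * Real.pi * Complex.I / p) ^ a.val = ZMod.stdAddChar a := by
  rw [ZMod.stdAddChar_apply, ZMod.toCircle_apply, ← Complex.exp_nat_mul]
  congr 1
  ring

lemma sum_stdAddChar_mul {p : ℕ} [Fact p.Prime] (b : ZMod p) :
    ∑ a : ZMod p, (ZMod.stdAddChar (a * b) : ℂ) = if b = 0 then (p : ℂ) else 0 := by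
  rw [AddChar.sum_mulShift b (ZMod.isPrimitive_stdAddChar p), ZMod.card]
  split_ifs <;> simp

/-- Counting zeros of a `ZMod p`-valued function by additive characters. -/
lemma card_mul_filter_eq_zero {p : ℕ} [Fact p.Prime] {α : Type*} [Fintype α]
    (g : α → ZMod p) :
    (p : ℂ) * (#{x | g x = 0} : ℂ) =
      Fintype.card α +
        ∑ a ∈ univ \ {(0 : ZMod p)}, ∑ x, (ZMod.stdAddChar (a * g x) : ℂ) := by
  have h : ∑ a : ZMod p, ∑ x, (ZMod.stdAddChar (a * g x) : ℂ) = p * (#{x | g x = 0} : ℂ) := by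
    rw [sum_comm]
    simp only [sum_stdAddChar_mul]
    rw [← sum_filter, sum_const, nsmul_eq_mul, mul_comm]
  rw [← h, ← sum_sdiff (subset_univ {(0 : ZMod p)}), add_comm]
  simp

/-- Restricting to nonzero arguments a function that vanishes at zero does not change the number
of arguments at which it is nonzero. -/
lemma hammingNorm_restrict_add_card_filter {R β : Type*} [Zero R] [DecidableEq R] [Fintype R]
    [Zero β] [DecidableEq β] (g : R → β) (hg : g 0 = 0) :
    hammingNorm (fun x : {x : R // x ≠ 0} => g x.1) + #{x | g x = 0} = Fintype.card R := by
  have h : hammingNorm (fun x : {x : R // x ≠ 0} => g x.1) = #{x | g x ≠ 0} := by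
    unfold hammingNorm
    refine card_bij (fun x _ => x.1) (by simp) (fun _ _ _ _ h => Subtype.ext h) fun b hb => ?_
    have hb' : g b ≠ 0 := by simpa using hb
    exact ⟨⟨b, fun h => hb' (h ▸ hg)⟩, by simpa using hb', rfl⟩
  rw [h, add_comm, card_filter_add_card_filter_not, card_univ]

lemma hammingNorm_restrict_eq {p m : ℕ} [Fact p.Prime] (hm : 0 < m) {R : Type*} [Zero R]
    [DecidableEq R] [Fintype R] (hR : Fintype.card R = p ^ m) (g : R → ZMod p) (hg : g 0 = 0) :
    (hammingNorm (fun x : {x : R // x ≠ 0} => g x.1) : ℂ) =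
      (p : ℂ) ^ m - (p : ℂ) ^ (m - 1) -
        (1 / (p : ℂ)) *
          ∑ a ∈ univ \ {(0 : ZMod p)}, ∑ x, (ZMod.stdAddChar (a * g x) : ℂ) := by
  have hp : (p : ℂ) ≠ 0 := Nat.cast_ne_zero.mpr (Fact.out : p.Prime).ne_zero
  have h₁ := card_mul_filter_eq_zero g
  have h₂ := congrArg (Nat.cast : ℕ → ℂ) (hammingNorm_restrict_add_card_filter g hg)
  rw [hR] at h₁ h₂
  push_cast at h₁ h₂
  obtain ⟨k, rfl⟩ := Nat.exists_eq_succ_of_ne_zero hm.ne'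
  rw [Nat.succ_eq_add_one, pow_succ] at h₁ h₂
  rw [Nat.succ_eq_add_one, Nat.add_sub_cancel, pow_succ, eq_sub_of_add_eq h₂]
  field_simp
  linear_combination -h₁

lemma sum_stdAddChar_trace_mul {p : ℕ} [Fact p.Prime] {F : Type*} [Field F] [Fintype F]
    [Algebra (ZMod p) F] {a : ZMod p} (ha : a ≠ 0) {v : F} (hv : v ≠ 0) :
    ∑ x : F, (ZMod.stdAddChar (a * Algebra.trace (ZMod p) F (v * x)) : ℂ) = 0 := by
  let φ : F →+ ZMod p :=
    (AddMonoidHom.mulLeft a).comp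
      ((Algebra.trace (ZMod p) F).toAddMonoidHom.comp (AddMonoidHom.mulLeft v))
  have hne : (ZMod.stdAddChar (N := p)).compAddMonoidHom φ ≠ 1 := by
    intro h
    obtain ⟨y, hy⟩ : ∃ y, Algebra.trace (ZMod p) F y ≠ 0 := by
      by_contra! h0
      exact Algebra.trace_ne_zero (ZMod p) F (LinearMap.ext h0)
    have h1 := DFunLike.congr_fun h (v⁻¹ * y)
    rw [AddChar.compAddMonoidHom_apply, AddChar.one_apply,
      ← AddChar.map_zero_eq_one (ZMod.stdAddChar (N := p))] at h1
    have h2 : a * Algebra.trace (ZMod p) F (v * (v⁻¹ * y)) = 0 :=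
      ZMod.injective_stdAddChar h1
    rw [mul_inv_cancel_left₀ hv] at h2
    exact mul_ne_zero ha hy h2
  exact AddChar.sum_eq_zero_of_ne_one hne

/-- The encoding map `(u, v) ↦ (u f(x) - Tr(vx))_{x ≠ 0}` as a linear map. -/
noncomputable def traceEncoder {p : ℕ} [Fact p.Prime] {F : Type*} [Field F] [Algebra (ZMod p) F]
    (f : F → ZMod p) : ZMod p × F →ₗ[ZMod p] ({x : F // x ≠ 0} → ZMod p) where
  toFun uv x := uv.1 * f x.1 - Algebra.trace (ZMod p) F (uv.2 * x.1)
  map_add' a b := by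
    ext x
    simp only [Prod.fst_add, Prod.snd_add, add_mul, map_add, Pi.add_apply]
    ring
  map_smul' r a := by
    ext x
    simp only [Prod.smul_fst, Prod.smul_snd, smul_mul_assoc, map_smul, Pi.smul_apply,
      smul_eq_mul, RingHom.id_apply]
    ring

lemma traceEncoder_injective {p : ℕ} [Fact p.Prime] {F : Type*} [Field F] [Finite F]
    [Algebra (ZMod p) F] (f : F → ZMod p) (hf0 : f 0 = 0)
    (hf : ∀ w : F, f ≠ fun x => Algebra.trace (ZMod p) F (w * x)) :
    Function.Injective (traceEncoder f) := by
  rw [injective_iff_map_eq_zero]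
  rintro ⟨u, v⟩ h
  have key : ∀ x : F, u * f x = Algebra.trace (ZMod p) F (v * x) := by
    intro x
    by_cases hx : x = 0
    · simp [hx, hf0]
    · exact sub_eq_zero.mp (congrFun h ⟨x, hx⟩)
  have hu : u = 0 := by
    by_contra hu
    refine hf (u⁻¹ • v) (funext fun x => ?_)
    rw [smul_mul_assoc, map_smul, ← key x, smul_eq_mul, inv_mul_cancel_left₀ hu]
  subst hu
  refine Prod.ext rfl ?_
  by_contra hv
  refine Algebra.trace_ne_zero (ZMod p) F (LinearMap.ext fun y => ?_)
  have := key (v⁻¹ * y)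
  rw [mul_inv_cancel_left₀ hv, zero_mul] at this
  exact this.symm

/-- For `p` an odd prime and `f : F_q → F_p` satisfying condition (★),
`C_f` is a `[p^m − 1, m + 1]` linear code over `F_p`, and the Hamming weight of the
codeword `(u f(x) − Tr(vx))_{x ∈ F_q^*}` equals `0` if `u = 0, v = 0`;
`p^m − p^{m−1}` if `u = 0, v ≠ 0`; and
`p^m − p^{m−1} − (1/p)·Σ_{c ∈ F_p^*} Σ_{x ∈ F_q} ζ_p^{c(u f(x) − Tr(vx))}` if `u ≠ 0`. -/
theorem odd_code_from_pary_function_parameters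
    {p m : ℕ} [Fact p.Prime] (hp : Odd p) (hm : 0 < m)
    (F : Type) [Field F] [Fintype F] [DecidableEq F]
    [Algebra (ZMod p) F] (hF : Fintype.card F = p ^ m)
    (f : F → ZMod p) (hf0 : f 0 = 0)
    (hf : ∀ w : F, f ≠ fun x => Algebra.trace (ZMod p) F (w * x)) :
    -- the primitive `p`-th root of unity `ζ_p = exp(2πi/p)`
    let ζ : ℂ := Complex.exp (2 * Real.pi * Complex.I / p)
    -- the absolute trace
    let Tr : F → ZMod p := fun x => Algebra.trace (ZMod p) F x
    -- the codewords of `C_f`, indexed by `x ∈ F_q^*`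
    let c : ZMod p × F → ({x : F // x ≠ 0} → ZMod p) :=
      fun uv x => uv.1 * f x.1 - Tr (uv.2 * x.1)
    -- `C_f` is a `[p^m − 1, m + 1]` code
    (Fintype.card {x : F // x ≠ 0} = p ^ m - 1) ∧
    (Module.finrank (ZMod p) (Submodule.span (ZMod p) (Set.range c)) = m + 1) ∧
    -- weights of the codewords
    (∀ u : ZMod p, ∀ v : F,
      (u = 0 → v = 0 → hammingNorm (c (u, v)) = 0) ∧
      (u = 0 → v ≠ 0 → (hammingNorm (c (u, v)) : ℂ) = (p : ℂ) ^ m - (p : ℂ) ^ (m - 1)) ∧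
      (u ≠ 0 → (hammingNorm (c (u, v)) : ℂ) =
        (p : ℂ) ^ m - (p : ℂ) ^ (m - 1) -
          (1 / (p : ℂ)) * ∑ c' ∈ Finset.univ \ {(0 : ZMod p)}, ∑ x : F,
            ζ ^ ((c' * (u * f x - Tr (v * x))).val))) := by
  intro ζ Tr c
  have hg : ∀ u : ZMod p, ∀ v : F, (hammingNorm (c (u, v)) : ℂ) =
      (p : ℂ) ^ m - (p : ℂ) ^ (m - 1) -
        (1 / (p : ℂ)) * ∑ c' ∈ Finset.univ \ {(0 : ZMod p)}, ∑ x : F,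
          (ZMod.stdAddChar (c' * (u * f x - Tr (v * x))) : ℂ) := fun u v =>
    hammingNorm_restrict_eq hm hF (fun x => u * f x - Tr (v * x)) (by simp [hf0, Tr])
  refine ⟨?_, ?_, fun u v => ⟨?_, ?_, ?_⟩⟩
  · rw [Fintype.card_subtype_compl, hF, Fintype.card_subtype_eq]
  · have hfin : Module.finrank (ZMod p) F = m := by
      have h := Module.card_eq_pow_finrank (K := ZMod p) (V := F)
      rw [hF, ZMod.card] at h
      exact (Nat.pow_right_injective (Fact.out : p.Prime).two_le h).symm
    have hc : Set.range c = (LinearMap.range (traceEncoder f) : Set _) := rfl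
    rw [hc, Submodule.span_eq,
      LinearMap.finrank_range_of_inj (traceEncoder_injective f hf0 hf),
      Module.finrank_prod, Module.finrank_self, hfin, add_comm]
  · rintro rfl rfl
    rw [hammingNorm_eq_zero]
    ext x
    simp [c, Tr]
  · rintro rfl hv
    rw [hg, sum_eq_zero, mul_zero, sub_zero]
    intro a ha
    have ha' : -a ≠ 0 := by simpa using ha
    rw [← sum_stdAddChar_trace_mul ha' hv]
    simp [Tr]
  · intro _
    rw [hg]
    simp only [ζ, exp_pow_val_eq_stdAddChar]
end

section
/- Let p = 2, let D ⊆ F_q^* and D̄ = F_q^* \ D, and suppose both characteristic functions f_D and f_{D̄} satisfy condition (★). Then the code C_{f_{D̄}} has length q−1 and dimension m+1 over F_2, and the multiset of Hamming weights of its codewords is the multiset union {(q − 2 + f̂_D(w))/2 : w ∈ F_q} ∪ {2^{m−1} : w ∈ F_q^*} ∪ {0}. -/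
open Finset

/-- Summing the signs of a binary vector yields its length minus twice its weight. -/
theorem two_mul_hammingNorm_eq_card_sub_sum {ι : Type*} [Fintype ι] (g : ι → ZMod 2) :
    2 * (hammingNorm g : ℤ) = Fintype.card ι - ∑ i, (-1 : ℤ) ^ (g i).val := by
  have h : ∀ a : ZMod 2, (-1 : ℤ) ^ a.val = 1 - 2 * (if a ≠ 0 then 1 else 0) := by decide
  simp only [h, Finset.sum_sub_distrib, ← Finset.mul_sum, Finset.sum_boole, hammingNorm]
  simp

theorem neg_one_pow_val_add (a b : ZMod 2) :
    (-1 : ℤ) ^ (a + b).val = (-1) ^ a.val * (-1) ^ b.val := by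
  revert a b; decide

theorem sum_eq_add_sum_ne_zero {F M : Type*} [Zero F] [Fintype F] [DecidableEq F]
    [AddCommMonoid M] (g : F → M) :
    ∑ x, g x = g 0 + ∑ x : {x : F // x ≠ 0}, g x := by
  rw [Fintype.sum_eq_add_sum_compl 0]
  congr 1
  exact Finset.sum_subtype _ (by simp) g

theorem univ_val_eq_zero_cons {F : Type*} [Zero F] [Fintype F] [DecidableEq F] :
    (Finset.univ : Finset F).val =
      0 ::ₘ (Finset.univ : Finset {x : F // x ≠ 0}).val.map Subtype.val := by
  have h : (Finset.univ : Finset F) =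
      Finset.cons 0 (Finset.univ.map (Function.Embedding.subtype fun x : F => x ≠ 0))
        (by simp) := by
    ext x
    by_cases hx : x = 0 <;> simp [hx]
  rw [h]
  rfl

theorem exists_trace_mul_ne_zero {F : Type*} [Field F] [Finite F] [Algebra (ZMod 2) F]
    {v : F} (hv : v ≠ 0) : ∃ x, Algebra.trace (ZMod 2) F (v * x) ≠ 0 := by
  by_contra! h
  exact hv ((traceForm_nondegenerate (ZMod 2) F).1 v h)

theorem sum_neg_one_pow_trace_mul {F : Type*} [Field F] [Fintype F] [Algebra (ZMod 2) F]
    {v : F} (hv : v ≠ 0) : ∑ x : F, (-1 : ℤ) ^ (Algebra.trace (ZMod 2) F (v * x)).val = 0 := by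
  obtain ⟨y, hy⟩ := exists_trace_mul_ne_zero hv
  have hs : ∀ a : ZMod 2, a ≠ 0 → (-1 : ℤ) ^ a.val = -1 := by decide
  have h := Equiv.sum_comp (Equiv.addRight y)
    fun x => (-1 : ℤ) ^ (Algebra.trace (ZMod 2) F (v * x)).val
  simp only [Equiv.coe_addRight, mul_add, map_add, neg_one_pow_val_add, hs _ hy,
    ← Finset.sum_mul] at h
  linarith

/-- Let `p = 2`, `D ⊆ F_q^*`, `D̄ = F_q^* \ D`, with both characteristic
functions `f_D` and `f_{D̄}` satisfying condition (★). Then `C_{f_{D̄}}` has length `q − 1`,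
dimension `m + 1`, and its multiset of Hamming weights is
`{(q − 2 + f̂_D(w))/2 : w ∈ F_q} ∪ {2^{m−1} : w ∈ F_q^*} ∪ {0}`. -/
theorem binary_code_from_complement_charFun_parameters
    {m : ℕ} (hm : 0 < m) (F : Type) [Field F] [Fintype F] [DecidableEq F]
    [Algebra (ZMod 2) F] (hF : Fintype.card F = 2 ^ m)
    (D : Finset F) (hD : (0 : F) ∉ D) :
    -- the absolute trace
    let Tr : F → ZMod 2 := fun x => Algebra.trace (ZMod 2) F x
    -- characteristic function of a subset
    let fch : Finset F → F → ZMod 2 := fun S x => if x ∈ S then 1 else 0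
    -- the Walsh transform (with `ζ_2 = −1`)
    let W : (F → ZMod 2) → F → ℤ := fun f w =>
      ∑ x : F, (-1 : ℤ) ^ ((f x).val + (Tr (w * x)).val)
    -- the complement `D̄ = F_q^* \ D`
    let Dbar : Finset F := (Finset.univ.filter (fun x : F => x ≠ 0)) \ D
    -- the codewords of `C_{f_{D̄}}`, indexed by `x ∈ F_q^*`
    let c : ZMod 2 × F → ({x : F // x ≠ 0} → ZMod 2) :=
      fun uv x => uv.1 * fch Dbar x.1 - Tr (uv.2 * x.1)
    -- condition (★) for `f_D`
    (fch D 0 = 0 ∧ ∀ w : F, fch D ≠ fun x => Tr (w * x)) →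
    -- condition (★) for `f_{D̄}`
    (fch Dbar 0 = 0 ∧ ∀ w : F, fch Dbar ≠ fun x => Tr (w * x)) →
    -- length `q − 1`
    (Fintype.card {x : F // x ≠ 0} = 2 ^ m - 1) ∧
    -- dimension `m + 1`
    (Module.finrank (ZMod 2) (Submodule.span (ZMod 2) (Set.range c)) = m + 1) ∧
    -- weight distribution
    (Multiset.map (fun uv => (hammingNorm (c uv) : ℤ)) (Finset.univ : Finset (ZMod 2 × F)).val =
      Multiset.map (fun w : F => ((2 ^ m : ℤ) - 2 + W (fch D) w) / 2)
        (Finset.univ : Finset F).val +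
      Multiset.map (fun _ : {x : F // x ≠ 0} => (2 ^ (m - 1) : ℤ))
        (Finset.univ : Finset {x : F // x ≠ 0}).val +
      {0}) := by
  intro Tr fch W Dbar c _ hstar
  have hcard : Fintype.card {x : F // x ≠ 0} = 2 ^ m - 1 := by
    rw [Fintype.card_subtype_compl, hF, Fintype.card_subtype_eq]
  have hcardZ : (Fintype.card {x : F // x ≠ 0} : ℤ) = 2 ^ m - 1 := by
    rw [hcard, Nat.cast_sub Nat.one_le_two_pow]
    simp
  have hTr0 : Tr 0 = 0 := map_zero _
  refine ⟨hcard, ?_, ?_⟩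
  · let L : ZMod 2 × F →ₗ[ZMod 2] ({x : F // x ≠ 0} → ZMod 2) :=
      { toFun := c
        map_add' := fun a b => by
          ext x
          simp only [c, Tr, Prod.fst_add, Prod.snd_add, add_mul, map_add, Pi.add_apply]
          ring
        map_smul' := fun r a => by
          ext x
          simp only [c, Tr, Prod.smul_fst, Prod.smul_snd, smul_mul_assoc, map_smul,
            Pi.smul_apply, smul_eq_mul, RingHom.id_apply]
          ring }
    have hinj : Function.Injective L := by
      rw [← LinearMap.ker_eq_bot, LinearMap.ker_eq_bot']
      rintro ⟨u, v⟩ h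
      have hx : ∀ x : F, u * fch Dbar x = Tr (v * x) := by
        intro x
        by_cases hx : x = 0
        · simp [hx, hstar.1, hTr0]
        · exact sub_eq_zero.mp (congrFun h ⟨x, hx⟩)
      have hu : ∀ a : ZMod 2, a = 0 ∨ a = 1 := by decide
      obtain rfl | rfl := hu u
      · by_cases hv : v = 0
        · simp [hv]
        · obtain ⟨y, hy⟩ := exists_trace_mul_ne_zero hv
          exact absurd ((hx y).symm.trans (zero_mul _)) hy
      · exact absurd (funext fun x => by simpa using hx x) (hstar.2 v)
    have hm' : Module.finrank (ZMod 2) F = m := by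
      have h := Module.card_eq_pow_finrank (K := ZMod 2) (V := F)
      rw [hF, ZMod.card] at h
      exact (Nat.pow_right_injective le_rfl h).symm
    have hr : Set.range c = (LinearMap.range L : Set _) := rfl
    rw [hr, Submodule.span_eq, LinearMap.finrank_range_of_inj hinj, Module.finrank_prod, hm',
      Module.finrank_self, add_comm]
  · have hzero : (hammingNorm (c (0, 0)) : ℤ) = 0 := by
      have : c (0, 0) = 0 := by ext x; simp [c, hTr0]
      simp [this]
    have hlin : ∀ v : {x : F // x ≠ 0}, (hammingNorm (c (0, v.1)) : ℤ) = 2 ^ (m - 1) := by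
      intro v
      have h := two_mul_hammingNorm_eq_card_sub_sum (c (0, v.1))
      have hs := sum_neg_one_pow_trace_mul v.2
      rw [sum_eq_add_sum_ne_zero] at hs
      have hc : ∀ x, c (0, v.1) x = Algebra.trace (ZMod 2) F (v.1 * x.1) := by
        intro x
        simp [c, Tr, CharTwo.neg_eq]
      simp only [hc] at h
      simp only [mul_zero, map_zero, ZMod.val_zero, pow_zero] at hs
      have hp : (2 : ℤ) ^ m = 2 * 2 ^ (m - 1) := by
        rw [← pow_succ', Nat.sub_add_cancel hm]
      linarith
    have haff : ∀ w : F, (hammingNorm (c (1, w)) : ℤ) = (2 ^ m - 2 + W (fch D) w) / 2 := by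
      intro w
      have h := two_mul_hammingNorm_eq_card_sub_sum (c (1, w))
      have hW : W (fch D) w = 1 + ∑ x : {x : F // x ≠ 0},
          (-1 : ℤ) ^ ((fch D x.1).val + (Tr (w * x.1)).val) := by
        simp only [W]
        rw [sum_eq_add_sum_ne_zero]
        simp [fch, hD, hTr0]
      have hsign : ∀ a : ZMod 2, (-1 : ℤ) ^ (1 - a).val = -(-1) ^ a.val ∧
          (-1 : ℤ) ^ (0 - a).val = (-1) ^ a.val := by decide
      have hc : ∀ x : {x : F // x ≠ 0}, (-1 : ℤ) ^ (c (1, w) x).val =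
          -(-1 : ℤ) ^ ((fch D x.1).val + (Tr (w * x.1)).val) := by
        intro x
        by_cases hx : x.1 ∈ D
        · simp only [c, fch, Dbar, hx, one_mul, mem_sdiff, not_true, and_false, if_false,
            if_true, (hsign _).2, pow_add, ZMod.val_one]
          ring
        · have hx' : x.1 ∈ Dbar := by simp [Dbar, hx, x.2]
          simp only [c, fch, hx, hx', one_mul, if_false, if_true, (hsign _).1, pow_add,
            ZMod.val_zero, pow_zero]
      simp only [hc, Finset.sum_neg_distrib] at h
      omega
    have huniv : (Finset.univ : Finset (ZMod 2 × F)).val =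
        (Finset.univ : Finset F).val.map (Prod.mk 1) +
          (Finset.univ : Finset F).val.map (Prod.mk 0) := by
      have h2 : (Finset.univ : Finset (ZMod 2)).val = 1 ::ₘ {0} := by decide
      rw [← Finset.univ_product_univ, Finset.product_val, h2, Multiset.cons_product]
      congr 1
      rw [← Multiset.cons_zero, Multiset.cons_product, Multiset.zero_product, add_zero]
    rw [huniv, Multiset.map_add, add_assoc]
    congr 1
    · rw [Multiset.map_map]
      exact Multiset.map_congr rfl fun w _ => haff w
    · rw [Multiset.map_map, univ_val_eq_zero_cons, Multiset.map_cons, Multiset.map_map, add_comm,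
        Multiset.singleton_add]
      congr 1
      exact Multiset.map_congr rfl fun v _ => hlin v
end
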